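/- Let n = 2^m, 0 ≤ i ≤ n−1, u_{2i} ∈ F_2^{2i+1} and u_{2i+1} ∈ F_2, and write u_{2i−1} for the first 2i entries of u_{2i}. Then the polar coset of length 2n satisfies C_{2n}^{(2i+1)}(u_{2i}, u_{2i+1}) = { (c_1, c_2) : c_1 ∈ C_n^{(i)}(u_{2i−1,even} ⊕ u_{2i−1,odd}, u_{2i} ⊕ u_{2i+1}), c_2 ∈ C_n^{(i)}(u_{2i−1,odd}, u_{2i+1}) }, where (c_1, c_2) denotes concatenation and u_{2i} in the second argument of the first coset denotes the last entry of the prefix u_{2i}. -/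

import Mathlib

open Matrix

/-- The 2×2 polar kernel over F₂. -/
def K2 : Matrix (Fin 2) (Fin 2) (ZMod 2) := !![1, 0; 1, 1]

/-- The `m`-fold Kronecker power of `K2`, rows and columns indexed by
binary expansions (bit `k` of the index corresponds to the `k`-th factor). -/
def kronPow (m : ℕ) : Matrix (Fin (2 ^ m)) (Fin (2 ^ m)) (ZMod 2) :=
  Matrix.of fun i j => ∏ k ∈ Finset.range m,
    K2 ⟨i.val / 2 ^ k % 2, Nat.mod_lt _ (by norm_num)⟩
       ⟨j.val / 2 ^ k % 2, Nat.mod_lt _ (by norm_num)⟩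

/-- Reversal of the `m`-bit binary expansion of `i`. -/
def bitrev (m i : ℕ) : ℕ := ∑ k ∈ Finset.range m, (i / 2 ^ k % 2) * 2 ^ (m - 1 - k)

/-- The `2^m × 2^m` bit-reversal permutation matrix. -/
def Bmat (m : ℕ) : Matrix (Fin (2 ^ m)) (Fin (2 ^ m)) (ZMod 2) :=
  Matrix.of fun i j => if (j : ℕ) = bitrev m i.val then 1 else 0

/-- The polar transformation matrix `G_n = B_n K_2^{⊗ m}`, `n = 2^m`. -/
def Gmat (m : ℕ) : Matrix (Fin (2 ^ m)) (Fin (2 ^ m)) (ZMod 2) := Bmat m * kronPow m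

/-- Assembling the vector `(u_{i-1}, u_i, u')` out of a prefix `p` of length `i`,
a bit `b`, and a suffix `s` of length `n - 1 - i`. -/
def assemble {n : ℕ} (i : ℕ) (p : Fin i → ZMod 2) (b : ZMod 2)
    (s : Fin (n - 1 - i) → ZMod 2) : Fin n → ZMod 2 :=
  fun j =>
    if h : (j : ℕ) < i then p ⟨j, h⟩
    else if h2 : (j : ℕ) = i then b
    else s ⟨(j : ℕ) - i - 1, by have h3 := j.isLt; omega⟩

/-- The polar coset `C_n^{(i)}(u_{i-1}, u_i)`, `n = 2^m`. -/
def polarCoset (m i : ℕ) (p : Fin i → ZMod 2) (b : ZMod 2) :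
    Set (Fin (2 ^ m) → ZMod 2) :=
  { c | ∃ s : Fin (2 ^ m - 1 - i) → ZMod 2, c = (assemble i p b s) ᵥ* Gmat m }

/-- Even-index subvector. -/
def evPart {i : ℕ} (p : Fin (2 * i) → ZMod 2) : Fin i → ZMod 2 :=
  fun k => p ⟨2 * k.val, by have := k.isLt; omega⟩

/-- Odd-index subvector. -/
def odPart {i : ℕ} (p : Fin (2 * i) → ZMod 2) : Fin i → ZMod 2 :=
  fun k => p ⟨2 * k.val + 1, by have := k.isLt; omega⟩

/-- Concatenation of two length-`2^m` vectors into a length-`2^(m+1)` vector. -/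
def concatPow {m : ℕ} (a b : Fin (2 ^ m) → ZMod 2) : Fin (2 ^ (m + 1)) → ZMod 2 :=
  fun j =>
    if h : (j : ℕ) < 2 ^ m then a ⟨j, h⟩
    else b ⟨(j : ℕ) - 2 ^ m, by
      have h1 := j.isLt
      have h2 : (2 : ℕ) ^ (m + 1) = 2 ^ m * 2 := pow_succ 2 m
      have h3 : 1 ≤ (2 : ℕ) ^ m := Nat.one_le_two_pow
      omega⟩

/-- The weight enumerating function `A_n^{(i)}(u_{i-1}, u_i)(X)` of a polar coset. -/
noncomputable def cosetWEF (m i : ℕ) (p : Fin i → ZMod 2) (b : ZMod 2) : Polynomial ℕ :=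
  ∑ c ∈ (polarCoset m i p b).toFinite.toFinset, Polynomial.X ^ hammingNorm c

/-- The first `2i` entries of a prefix of length `2i + 1`. -/
def initPart {i : ℕ} (p : Fin (2 * i + 1) → ZMod 2) : Fin (2 * i) → ZMod 2 :=
  fun k => p ⟨k.val, by have := k.isLt; omega⟩

theorem bitrev_succ (m i : ℕ) : bitrev (m + 1) i = bitrev m (i / 2) + i % 2 * 2 ^ m := by
  unfold bitrev
  rw [Finset.sum_range_succ']
  congr 1
  · refine Finset.sum_congr rfl fun k _ => ?_
    rw [Nat.div_div_eq_div_mul, ← pow_succ', show m + 1 - 1 - (k + 1) = m - 1 - k by omega]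
  · simp

theorem bitrev_lt (m i : ℕ) : bitrev m i < 2 ^ m := by
  induction m generalizing i with
  | zero => simp [bitrev]
  | succ m ih =>
    rw [bitrev_succ, pow_succ]
    have := ih (i / 2)
    rcases Nat.mod_two_eq_zero_or_one i with h | h <;> rw [h] <;> omega

theorem Gmat_apply (m : ℕ) (i j : Fin (2 ^ m)) :
    Gmat m i j = kronPow m ⟨bitrev m i, bitrev_lt m i⟩ j := by
  rw [Gmat, Matrix.mul_apply, Finset.sum_eq_single ⟨bitrev m i, bitrev_lt m i⟩]
  · simp [Bmat]
  · intro k _ hk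
    have : (k : ℕ) ≠ bitrev m i := fun h => hk (Fin.ext h)
    simp [Bmat, this]
  · simp

theorem div_two_pow_mod_two_of_lt {m k : ℕ} (hk : k < m) (a : ℕ) :
    a % 2 ^ m / 2 ^ k % 2 = a / 2 ^ k % 2 := by
  obtain ⟨d, rfl⟩ := Nat.exists_eq_add_of_lt hk
  rw [show k + d + 1 = k + (d + 1) by omega, pow_add, Nat.mod_mul_right_div_self,
    Nat.mod_mod_of_dvd _ (dvd_pow_self 2 (Nat.succ_ne_zero d))]

theorem kronPow_succ (m : ℕ) (i j : Fin (2 ^ (m + 1))) :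
    kronPow (m + 1) i j =
      kronPow m ⟨i % 2 ^ m, Nat.mod_lt _ (by positivity)⟩ ⟨j % 2 ^ m, Nat.mod_lt _ (by positivity)⟩ *
        K2 ⟨i / 2 ^ m % 2, Nat.mod_lt _ (by norm_num)⟩
          ⟨j / 2 ^ m % 2, Nat.mod_lt _ (by norm_num)⟩ := by
  simp only [kronPow, Matrix.of_apply, Finset.prod_range_succ]
  congr 1
  refine Finset.prod_congr rfl fun k hk => ?_
  have hk := Finset.mem_range.mp hk
  simp only [div_two_pow_mod_two_of_lt hk]

theorem Fin.div_two_lt_two_pow {m : ℕ} (i : Fin (2 ^ (m + 1))) : (i : ℕ) / 2 < 2 ^ m :=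
  Nat.div_lt_of_lt_mul (i.isLt.trans_eq (pow_succ' 2 m))

theorem Gmat_succ (m : ℕ) (i j : Fin (2 ^ (m + 1))) :
    Gmat (m + 1) i j =
      Gmat m ⟨i / 2, i.div_two_lt_two_pow⟩
          ⟨j % 2 ^ m, Nat.mod_lt _ (by positivity)⟩ *
        K2 ⟨i % 2, Nat.mod_lt _ (by norm_num)⟩
          ⟨j / 2 ^ m % 2, Nat.mod_lt _ (by norm_num)⟩ := by
  have h := bitrev_lt m (i / 2)
  have hpos : 0 < 2 ^ m := by positivity
  simp only [Gmat_apply, kronPow_succ, bitrev_succ, Nat.add_mul_mod_self_right,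
    Nat.mod_eq_of_lt h, Nat.add_mul_div_right _ _ hpos, Nat.div_eq_of_lt h, zero_add, Nat.mod_mod]

/-- The even-index entries of a vector of length `2^(m+1)`. -/
def evenEntries {m : ℕ} (u : Fin (2 ^ (m + 1)) → ZMod 2) : Fin (2 ^ m) → ZMod 2 :=
  fun k => u ⟨2 * k, by have := k.isLt; rw [pow_succ]; omega⟩

/-- The odd-index entries of a vector of length `2^(m+1)`. -/
def oddEntries {m : ℕ} (u : Fin (2 ^ (m + 1)) → ZMod 2) : Fin (2 ^ m) → ZMod 2 :=
  fun k => u ⟨2 * k + 1, by have := k.isLt; rw [pow_succ]; omega⟩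

theorem sum_fin_two_pow_succ {M : Type*} [AddCommMonoid M] (m : ℕ) (f : Fin (2 ^ (m + 1)) → M) :
    ∑ i, f i = ∑ k : Fin (2 ^ m),
      (f ⟨2 * k, by have := k.isLt; rw [pow_succ]; omega⟩ +
        f ⟨2 * k + 1, by have := k.isLt; rw [pow_succ]; omega⟩) := by
  rw [← (finProdFinEquiv.trans (finCongr (pow_succ 2 m).symm)).sum_comp, Fintype.sum_prod_type]
  refine Finset.sum_congr rfl fun k _ => ?_
  rw [Fin.sum_univ_two]
  congr 2 <;> ext <;> simp [add_comm]

theorem vecMul_Gmat_succ (m : ℕ) (u : Fin (2 ^ (m + 1)) → ZMod 2) :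
    u ᵥ* Gmat (m + 1) =
      concatPow ((evenEntries u + oddEntries u) ᵥ* Gmat m) (oddEntries u ᵥ* Gmat m) := by
  funext j
  have hj : (j : ℕ) < 2 ^ m * 2 := j.isLt.trans_eq (pow_succ 2 m)
  have hodd (k : ℕ) : (2 * k + 1) / 2 = k := by omega
  simp only [Matrix.vecMul, dotProduct, concatPow, sum_fin_two_pow_succ, Gmat_succ]
  split_ifs with h
  · refine Finset.sum_congr rfl fun k _ => ?_
    simp [K2, Nat.div_eq_of_lt h, Nat.mod_eq_of_lt h, evenEntries, oddEntries, hodd, add_mul,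
      Nat.add_mod]
  · have hdiv : (j : ℕ) / 2 ^ m = 1 := Nat.div_eq_of_lt_le (by omega) (by omega)
    have hmod : (j : ℕ) % 2 ^ m = j - 2 ^ m := by
      rw [Nat.mod_eq_sub_mod (by omega), Nat.mod_eq_of_lt (by omega)]
    refine Finset.sum_congr rfl fun k _ => ?_
    simp [K2, hdiv, hmod, oddEntries, hodd, Nat.add_mod]

theorem mem_polarCoset_iff {m i : ℕ} (hi : i < 2 ^ m) (p : Fin i → ZMod 2) (b : ZMod 2)
    (c : Fin (2 ^ m) → ZMod 2) :
    c ∈ polarCoset m i p b ↔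
      ∃ u : Fin (2 ^ m) → ZMod 2,
        (∀ j : Fin i, u ⟨j, j.isLt.trans hi⟩ = p j) ∧ u ⟨i, hi⟩ = b ∧ c = u ᵥ* Gmat m := by
  constructor
  · rintro ⟨s, rfl⟩
    exact ⟨assemble i p b s, fun j => by simp [assemble], by simp [assemble], rfl⟩
  · rintro ⟨u, hp, hb, rfl⟩
    refine ⟨fun k => u ⟨i + 1 + k, by have := k.isLt; omega⟩, ?_⟩
    congr 1
    funext j
    unfold assemble
    split_ifs with h h2
    · exact hp ⟨j, h⟩
    · rw [← hb]
      exact congrArg u (Fin.ext h2)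
    · exact congrArg u (Fin.ext (by simp only; omega))

/-- The vector with prescribed even-index and odd-index entries. -/
def interleave {m : ℕ} (v w : Fin (2 ^ m) → ZMod 2) : Fin (2 ^ (m + 1)) → ZMod 2 :=
  fun j =>
    have hj : (j : ℕ) / 2 < 2 ^ m := j.div_two_lt_two_pow
    if (j : ℕ) % 2 = 0 then v ⟨j / 2, hj⟩ else w ⟨j / 2, hj⟩

theorem evenEntries_interleave {m : ℕ} (v w : Fin (2 ^ m) → ZMod 2) :
    evenEntries (interleave v w) = v := by
  funext k
  simp [evenEntries, interleave]

theorem oddEntries_interleave {m : ℕ} (v w : Fin (2 ^ m) → ZMod 2) :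
    oddEntries (interleave v w) = w := by
  funext k
  have h : (2 * (k : ℕ) + 1) / 2 = k := by omega
  simp [oddEntries, interleave, h, Nat.add_mod]

/-- The odd-index polar coset recursion:
`C_{2n}^{(2i+1)}(u_{2i}, u_{2i+1})` is the set of concatenations `(c₁, c₂)` with
`c₁ ∈ C_n^{(i)}(u_{2i-1,even} ⊕ u_{2i-1,odd}, u_{2i} ⊕ u_{2i+1})` and
`c₂ ∈ C_n^{(i)}(u_{2i-1,odd}, u_{2i+1})`, where `u_{2i-1}` consists of the first
`2i` entries of the prefix `u_{2i}`, whose last entry is `p ⟨2i, _⟩`. -/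
theorem polarCoset_odd_rec (m i : ℕ) (hi : i < 2 ^ m)
    (p : Fin (2 * i + 1) → ZMod 2) (b : ZMod 2) :
    polarCoset (m + 1) (2 * i + 1) p b =
      { c | ∃ c1 ∈ polarCoset m i (evPart (initPart p) + odPart (initPart p))
                (p ⟨2 * i, by omega⟩ + b),
            ∃ c2 ∈ polarCoset m i (odPart (initPart p)) b,
            c = concatPow c1 c2 } := by
  have hi2 : 2 * i + 1 < 2 ^ (m + 1) := by rw [pow_succ]; omega
  ext c
  simp only [Set.mem_ofPred_eq, mem_polarCoset_iff hi, mem_polarCoset_iff hi2]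
  constructor
  · rintro ⟨u, hp, hb, rfl⟩
    refine ⟨_, ⟨evenEntries u + oddEntries u, fun j => ?_, ?_, rfl⟩,
      _, ⟨oddEntries u, fun j => ?_, hb, rfl⟩, vecMul_Gmat_succ m u⟩
    · exact congrArg₂ (· + ·) (hp ⟨2 * j, by omega⟩) (hp ⟨2 * j + 1, by omega⟩)
    · exact congrArg₂ (· + ·) (hp ⟨2 * i, by omega⟩) hb
    · exact hp ⟨2 * j + 1, by omega⟩
  · rintro ⟨_, ⟨v, hv, hvb, rfl⟩, _, ⟨w, hw, hwb, rfl⟩, rfl⟩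
    have hev := evenEntries_interleave (v + w) w
    have hod := oddEntries_interleave (v + w) w
    refine ⟨interleave (v + w) w, fun j => ?_, (congrFun hod ⟨i, hi⟩).trans hwb, ?_⟩
    · obtain ⟨j, hj⟩ := j
      obtain ⟨k, rfl | rfl⟩ : ∃ k, j = 2 * k ∨ j = 2 * k + 1 := ⟨j / 2, by omega⟩
      · refine (congrFun hev ⟨k, by omega⟩).trans ?_
        rw [Pi.add_apply]
        rcases (show k ≤ i by omega).lt_or_eq with hk | rfl
        · rw [hv ⟨k, hk⟩, hw ⟨k, hk⟩, Pi.add_apply, add_assoc, CharTwo.add_self_eq_zero, add_zero]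
          rfl
        · rw [hvb, hwb, add_assoc, CharTwo.add_self_eq_zero, add_zero]
      · exact (congrFun hod ⟨k, by omega⟩).trans (hw ⟨k, by omega⟩)
    · rw [vecMul_Gmat_succ, hev, hod, add_assoc, CharTwo.add_self_eq_zero w, add_zero]
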